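/- arXiv:1001.3984 — 3 statements merged into one kernel-verified Lean document; each statement's English description precedes it below -/
import Mathlib

section
/- Neither GF(8) nor GF(4) × GF(2) is the union of three proper subrings S₁, S₂, S₃ with no nonzero ideal contained in S₁ ∩ S₂ ∩ S₃; among semisimple unital rings of order 8, only GF(2) × GF(2) × GF(2) admits such a decomposition. -/
/-- A ring in which some element lies in no proper non-unital subring. -/
def HasNonUnitalGenerator (R : Type*) [NonUnitalNonAssocRing R] : Prop :=
  ∃ x : R, ∀ S : NonUnitalSubring R, x ∈ S → S = ⊤

namespace HasNonUnitalGenerator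

theorem eq_top_of_cover {R : Type*} [NonUnitalNonAssocRing R] (h : HasNonUnitalGenerator R)
    {S₁ S₂ S₃ : NonUnitalSubring R} (hc : ∀ r, r ∈ S₁ ∨ r ∈ S₂ ∨ r ∈ S₃) :
    S₁ = ⊤ ∨ S₂ = ⊤ ∨ S₃ = ⊤ := by
  obtain ⟨x, hx⟩ := h
  exact (hc x).imp (hx _) (Or.imp (hx _) (hx _))

theorem of_ringEquiv {R T : Type*} [NonUnitalNonAssocRing R] [NonUnitalNonAssocRing T]
    (e : R ≃+* T) (h : HasNonUnitalGenerator T) : HasNonUnitalGenerator R := by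
  obtain ⟨x, hx⟩ := h
  refine ⟨e.symm x, fun S hS => (NonUnitalSubring.eq_top_iff' S).2 fun y => ?_⟩
  have := hx (S.comap e.symm) hS
  have hy : e y ∈ S.comap e.symm := this ▸ NonUnitalSubring.mem_top _
  rw [NonUnitalSubring.mem_comap] at hy
  simpa using hy

end HasNonUnitalGenerator

theorem NonUnitalSubring.pow_succ_mem {R : Type*} [Ring R] (S : NonUnitalSubring R) {x : R}
    (hx : x ∈ S) (n : ℕ) : x ^ (n + 1) ∈ S := by
  induction n with
  | zero => simpa using hx
  | succ n ih => rw [pow_succ]; exact S.mul_mem ih hx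

theorem exists_forall_eq_pow_succ (K : Type*) [Field K] [Finite K] :
    ∃ x : K, x ≠ 0 ∧ ∀ y : K, y ≠ 0 → ∃ n : ℕ, y = x ^ (n + 1) := by
  obtain ⟨g, hg⟩ := IsCyclic.exists_generator (α := Kˣ)
  refine ⟨g, g.ne_zero, fun y hy => ?_⟩
  obtain ⟨n, hn⟩ := mem_powers_iff_mem_zpowers.2 (hg (Units.mk0 y hy * g⁻¹))
  refine ⟨n, ?_⟩
  have : g ^ (n + 1) = Units.mk0 y hy := by
    rw [pow_succ]; simp only at hn; rw [hn]; simp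
  simpa using (congrArg Units.val this).symm

theorem hasNonUnitalGenerator_of_finite_field (K : Type*) [Field K] [Finite K] :
    HasNonUnitalGenerator K := by
  obtain ⟨x, -, hx⟩ := exists_forall_eq_pow_succ K
  refine ⟨x, fun S hS => (NonUnitalSubring.eq_top_iff' S).2 fun y => ?_⟩
  rcases eq_or_ne y 0 with rfl | hy
  · exact S.zero_mem
  · obtain ⟨n, rfl⟩ := hx y hy
    exact S.pow_succ_mem hS n

theorem hasNonUnitalGenerator_prod {K L : Type*} [Field K] [Field L]
    (hK : Nat.card K = 4) (hL : Nat.card L = 2) : HasNonUnitalGenerator (K × L) := by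
  have : Finite K := Nat.finite_of_card_ne_zero (by omega)
  have : Finite L := Nat.finite_of_card_ne_zero (by omega)
  have := Fintype.ofFinite K
  have := Fintype.ofFinite L
  obtain ⟨x, hx0, hx⟩ := exists_forall_eq_pow_succ K
  have hK4 : (Fintype.card K) = 4 := by rw [← Nat.card_eq_fintype_card, hK]
  have hx3 : x ^ 3 = 1 := by simpa [hK4] using FiniteField.pow_card_sub_one_eq_one x hx0
  have hx1 : x ≠ 1 := by
    rintro rfl
    have hsub : (Finset.univ : Finset K).card ≤ 2 := by
      classical
      refine (Finset.card_le_card (t := {0, 1}) fun y _ => ?_).trans Finset.card_le_two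
      rcases eq_or_ne y 0 with rfl | hy
      · simp
      · obtain ⟨n, rfl⟩ := hx y hy
        simp
    rw [Finset.card_univ, hK4] at hsub
    omega
  have hxx : x ^ 2 + x + 1 = 0 := by
    have : (x - 1) * (x ^ 2 + x + 1) = 0 := by linear_combination hx3
    exact (mul_eq_zero.1 this).resolve_left (sub_ne_zero.2 hx1)
  have hL01 : ∀ b : L, b = 0 ∨ b = 1 := by
    intro b
    rw [or_iff_not_imp_left]
    intro hb
    simpa [← Nat.card_eq_fintype_card, hL] using FiniteField.pow_card_sub_one_eq_one b hb
  have hL2 : (1 : L) + 1 = 0 := (hL01 (1 + 1)).resolve_right (by simp)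
  have hK2 : (1 : K) + 1 = 0 := by
    have h : ((4 : ℕ) : K) = 0 := by
      rw [← hK4]; exact FiniteField.cast_card_eq_zero K
    have : ((1 : K) + 1) * (1 + 1) = 0 := by push_cast at h; linear_combination h
    exact mul_self_eq_zero.1 this
  refine ⟨(x, 1), fun S hS => (NonUnitalSubring.eq_top_iff' S).2 fun y => ?_⟩
  have h10 : ((1, 0) : K × L) ∈ S := by
    convert S.add_mem (S.mul_mem hS hS) hS using 1
    ext
    · simp only [Prod.fst_add, Prod.fst_mul]; linear_combination hK2 - hxx
    · simp [hL2]
  have h01 : ((0, 1) : K × L) ∈ S := by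
    convert S.sub_mem (S.pow_succ_mem hS 2) h10 using 1
    ext <;> simp [hx3]
  have hfst : ∀ a : K, ((a, 0) : K × L) ∈ S := fun a => by
    rcases eq_or_ne a 0 with rfl | ha
    · exact S.zero_mem
    · obtain ⟨n, rfl⟩ := hx a ha
      convert S.mul_mem h10 (S.pow_succ_mem hS n) using 1
      ext <;> simp
  obtain ⟨a, b⟩ := y
  rcases hL01 b with rfl | rfl
  · exact hfst a
  · convert S.add_mem (hfst a) h01 using 1
    simp

theorem IsSemisimpleRing.exists_ringEquiv_pi_field_of_card_lt {R : Type} [Ring R]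
    [IsSemisimpleRing R] [Finite R] (hR : Nat.card R < 16) :
    ∃ (n : ℕ) (K : Fin n → Type) (_ : ∀ i, Field (K i)),
      (∀ i, Finite (K i)) ∧ Nonempty (R ≃+* Π i, K i) := by
  obtain ⟨n, D, d, _, hd, ⟨e⟩⟩ := IsSemisimpleRing.exists_ringEquiv_pi_matrix_divisionRing R
  have hdvd : ∀ i, Nat.card (D i) ^ (d i * d i) ∣ Nat.card R := fun i => by
    have h : Nat.card (Matrix (Fin (d i)) (Fin (d i)) (D i)) = Nat.card (D i) ^ (d i * d i) := by
      unfold Matrix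
      rw [Nat.card_fun, Nat.card_fun, Nat.card_fin, pow_mul]
    rw [← h, Nat.card_congr e.toEquiv, Nat.card_pi]
    exact Finset.dvd_prod_of_mem _ (Finset.mem_univ i)
  have hpos : 0 < Nat.card R := Nat.card_pos
  have hfin : ∀ i, Finite (D i) := fun i => by
    refine Nat.finite_of_card_ne_zero fun h0 => ?_
    have := hdvd i
    rw [h0, zero_pow (mul_ne_zero (hd i).out (hd i).out), zero_dvd_iff] at this
    omega
  have hd1 : d = fun _ => 1 := funext fun i => by
    have h2 : 1 < Nat.card (D i) := Finite.one_lt_card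
    have hle := Nat.le_of_dvd hpos (hdvd i)
    by_contra hne
    have h0 := (hd i).out
    have h4 : 2 * 2 ≤ d i * d i := Nat.mul_le_mul (by omega) (by omega)
    have := (Nat.pow_le_pow_left h2 _).trans' (Nat.pow_le_pow_right two_pos h4)
    norm_num at this
    omega
  subst hd1
  exact ⟨n, D, fun i => littleWedderburn (D i), hfin,
    ⟨e.trans (RingEquiv.piCongrRight fun i => Matrix.uniqueRingEquiv)⟩⟩

/-- The ring of functions on `Fin 2` is a binary product. -/
def piFinTwoRingEquiv (K : Fin 2 → Type*) [∀ i, Semiring (K i)] : (Π i, K i) ≃+* K 0 × K 1 where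
  __ := piFinTwoEquiv K
  map_mul' _ _ := rfl
  map_add' _ _ := rfl

/-- The ring of functions on `Fin 3` is a ternary product. -/
def piFinThreeRingEquiv (K : Fin 3 → Type*) [∀ i, Semiring (K i)] :
    (Π i, K i) ≃+* K 0 × K 1 × K 2 where
  toFun f := (f 0, f 1, f 2)
  invFun x := fun i => match i with
    | 0 => x.1
    | 1 => x.2.1
    | 2 => x.2.2
  left_inv f := by ext i; fin_cases i <;> rfl
  right_inv _ := rfl
  map_mul' _ _ := rfl
  map_add' _ _ := rfl

theorem hasNonUnitalGenerator_or_nonempty_ringEquiv {R : Type} [Ring R] [IsSemisimpleRing R]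
    (hR : Nat.card R = 8) :
    HasNonUnitalGenerator R ∨ Nonempty (R ≃+* ZMod 2 × ZMod 2 × ZMod 2) := by
  have : Finite R := Nat.finite_of_card_ne_zero (by omega)
  obtain ⟨n, K, _, hfin, ⟨e⟩⟩ :=
    IsSemisimpleRing.exists_ringEquiv_pi_field_of_card_lt (R := R) (by omega)
  have hcard : ∏ i, Nat.card (K i) = 8 := by rw [← Nat.card_pi, ← Nat.card_congr e.toEquiv, hR]
  have h2 : ∀ i, 2 ≤ Nat.card (K i) := fun i => Finite.one_lt_card
  match n with
  | 0 => simp at hcard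
  | 1 =>
    exact .inl (.of_ringEquiv (e.trans (RingEquiv.piUnique K))
      (hasNonUnitalGenerator_of_finite_field _))
  | 2 =>
    left
    rw [Fin.prod_univ_two] at hcard
    have h0 := h2 0
    have h1 := h2 1
    have hle : Nat.card (K 0) ≤ 4 := by nlinarith
    have e' := e.trans (piFinTwoRingEquiv K)
    interval_cases hK : Nat.card (K 0)
    · exact .of_ringEquiv (e'.trans RingEquiv.prodComm)
        (hasNonUnitalGenerator_prod (by omega) hK)
    · omega
    · exact .of_ringEquiv e' (hasNonUnitalGenerator_prod hK (by omega))
  | 3 =>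
    right
    rw [Fin.prod_univ_three] at hcard
    have h0 := h2 0
    have h1 := h2 1
    have h3 := h2 2
    have hq : ∀ i, Nat.card (K i) = 2 := by
      have h01 := Nat.mul_le_mul h0 h1
      have h02 := Nat.mul_le_mul h0 h3
      have h12 := Nat.mul_le_mul h1 h3
      intro i
      fin_cases i
      · change Nat.card (K 0) = 2
        nlinarith
      · change Nat.card (K 1) = 2
        nlinarith
      · change Nat.card (K 2) = 2
        nlinarith
    have f : ∀ i, K i ≃+* ZMod 2 := fun i =>
      have := Fintype.ofFinite (K i)
      (ZMod.ringEquivOfPrime (K i) Nat.prime_two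
        (by rw [← Nat.card_eq_fintype_card, hq])).symm
    exact ⟨(e.trans (RingEquiv.piCongrRight f)).trans (piFinThreeRingEquiv fun _ => ZMod 2)⟩
  | n + 4 =>
    have hle := Finset.prod_le_prod' (s := Finset.univ) fun i (_ : i ∈ Finset.univ) => h2 i
    rw [hcard, Finset.prod_const, Finset.card_univ, Fintype.card_fin, pow_add] at hle
    have := Nat.one_le_two_pow (n := n)
    omega

theorem exists_cover_zmod_two_cubed :
    ∃ S₁ S₂ S₃ : NonUnitalSubring (ZMod 2 × ZMod 2 × ZMod 2),
      S₁ ≠ ⊤ ∧ S₂ ≠ ⊤ ∧ S₃ ≠ ⊤ ∧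
      (∀ r, r ∈ S₁ ∨ r ∈ S₂ ∨ r ∈ S₃) ∧
      (∀ I : TwoSidedIdeal (ZMod 2 × ZMod 2 × ZMod 2),
        (I : Set (ZMod 2 × ZMod 2 × ZMod 2)) ⊆
          ((S₁ ⊓ S₂ ⊓ S₃ : NonUnitalSubring (ZMod 2 × ZMod 2 × ZMod 2)) :
            Set (ZMod 2 × ZMod 2 × ZMod 2)) →
        I = ⊥) := by
  let p : ZMod 2 × ZMod 2 × ZMod 2 →+* ZMod 2 := RingHom.fst _ _
  let q : ZMod 2 × ZMod 2 × ZMod 2 →+* ZMod 2 := (RingHom.fst _ _).comp (RingHom.snd _ _)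
  let r : ZMod 2 × ZMod 2 × ZMod 2 →+* ZMod 2 := (RingHom.snd _ _).comp (RingHom.snd _ _)
  let S (f g : ZMod 2 × ZMod 2 × ZMod 2 →+* ZMod 2) :
      NonUnitalSubring (ZMod 2 × ZMod 2 × ZMod 2) := (f.eqLocus g).toNonUnitalSubring
  have hS : ∀ f g x, x ∈ S f g ↔ f x = g x := fun _ _ _ => Iff.rfl
  have hne : ∀ f g x, f x ≠ g x → S f g ≠ ⊤ := fun f g x hx h =>
    hx ((hS f g x).1 (h ▸ NonUnitalSubring.mem_top x))
  refine ⟨S p q, S p r, S q r, hne _ _ (1, 0, 0) (by simp [p, q]),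
    hne _ _ (1, 0, 0) (by simp [p, r]), hne _ _ (0, 1, 0) (by simp [q, r]), fun x => ?_,
    fun I hI => ?_⟩
  · simp only [hS]
    exact (by decide : ∀ a b c : ZMod 2, a = b ∨ a = c ∨ b = c) _ _ _
  · refine le_bot_iff.1 fun x hx => ?_
    have hx' := hI hx
    simp only [NonUnitalSubring.coe_inf, Set.mem_inter_iff, SetLike.mem_coe, hS] at hx'
    have hy := hI (I.mul_mem_left (1, 0, 0) x hx)
    simp only [NonUnitalSubring.coe_inf, Set.mem_inter_iff, SetLike.mem_coe, hS] at hy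
    obtain ⟨a, b, c⟩ := x
    simp [p, q, r] at hx' hy
    rw [TwoSidedIdeal.mem_bot]
    ext <;> simp_all


/-- Neither `GF(8)` nor `GF(4) × GF(2)` is the union of three proper subrings
`S₁, S₂, S₃` with no nonzero two-sided ideal contained in `S₁ ∩ S₂ ∩ S₃`;
`GF(2) × GF(2) × GF(2)` does admit such a decomposition; and among semisimple
unital rings of order 8 it is the only one that does. -/
theorem semisimple_good_rings_of_order_eight :
    (¬ ∃ S₁ S₂ S₃ : NonUnitalSubring (GaloisField 2 3),
      S₁ ≠ ⊤ ∧ S₂ ≠ ⊤ ∧ S₃ ≠ ⊤ ∧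
      (∀ r, r ∈ S₁ ∨ r ∈ S₂ ∨ r ∈ S₃) ∧
      (∀ I : TwoSidedIdeal (GaloisField 2 3),
        (I : Set (GaloisField 2 3)) ⊆
          ((S₁ ⊓ S₂ ⊓ S₃ : NonUnitalSubring (GaloisField 2 3)) : Set (GaloisField 2 3)) →
        I = ⊥)) ∧
    (¬ ∃ S₁ S₂ S₃ : NonUnitalSubring (GaloisField 2 2 × ZMod 2),
      S₁ ≠ ⊤ ∧ S₂ ≠ ⊤ ∧ S₃ ≠ ⊤ ∧
      (∀ r, r ∈ S₁ ∨ r ∈ S₂ ∨ r ∈ S₃) ∧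
      (∀ I : TwoSidedIdeal (GaloisField 2 2 × ZMod 2),
        (I : Set (GaloisField 2 2 × ZMod 2)) ⊆
          ((S₁ ⊓ S₂ ⊓ S₃ : NonUnitalSubring (GaloisField 2 2 × ZMod 2)) :
            Set (GaloisField 2 2 × ZMod 2)) →
        I = ⊥)) ∧
    (∃ S₁ S₂ S₃ : NonUnitalSubring (ZMod 2 × ZMod 2 × ZMod 2),
      S₁ ≠ ⊤ ∧ S₂ ≠ ⊤ ∧ S₃ ≠ ⊤ ∧
      (∀ r, r ∈ S₁ ∨ r ∈ S₂ ∨ r ∈ S₃) ∧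
      (∀ I : TwoSidedIdeal (ZMod 2 × ZMod 2 × ZMod 2),
        (I : Set (ZMod 2 × ZMod 2 × ZMod 2)) ⊆
          ((S₁ ⊓ S₂ ⊓ S₃ : NonUnitalSubring (ZMod 2 × ZMod 2 × ZMod 2)) :
            Set (ZMod 2 × ZMod 2 × ZMod 2)) →
        I = ⊥)) ∧
    (∀ (R : Type) (_ : Ring R), Nat.card R = 8 → IsSemisimpleRing R →
      (∃ S₁ S₂ S₃ : NonUnitalSubring R,
        S₁ ≠ ⊤ ∧ S₂ ≠ ⊤ ∧ S₃ ≠ ⊤ ∧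
        (∀ r : R, r ∈ S₁ ∨ r ∈ S₂ ∨ r ∈ S₃) ∧
        (∀ I : TwoSidedIdeal R,
          (I : Set R) ⊆ ((S₁ ⊓ S₂ ⊓ S₃ : NonUnitalSubring R) : Set R) → I = ⊥)) →
      Nonempty (R ≃+* (ZMod 2 × ZMod 2 × ZMod 2))) := by
  refine ⟨?_, ?_, exists_cover_zmod_two_cubed, ?_⟩
  · rintro ⟨S₁, S₂, S₃, h₁, h₂, h₃, hc, -⟩
    have := (hasNonUnitalGenerator_of_finite_field (GaloisField 2 3)).eq_top_of_cover hc
    tauto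
  · rintro ⟨S₁, S₂, S₃, h₁, h₂, h₃, hc, -⟩
    have := (hasNonUnitalGenerator_prod (K := GaloisField 2 2) (L := ZMod 2)
      (GaloisField.card 2 2 two_ne_zero) (Nat.card_zmod 2)).eq_top_of_cover hc
    tauto
  · rintro R _ hR _ ⟨S₁, S₂, S₃, h₁, h₂, h₃, hc, -⟩
    refine (hasNonUnitalGenerator_or_nonempty_ringEquiv hR).resolve_left fun h => ?_
    have := h.eq_top_of_cover hc
    tauto
end

section
/- For n ≥ 2, a prime divisor a of n, and a prime power q, the number of GL(n,q)-conjugates of the subring M_{n/a}(q^a) inside M_n(q) equals |GL(n,q)| / (a·|GL(n/a,q^a)|). -/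
open Module

theorem Nat.card_eq_card_mul_of_card_fiber_eq {α β : Type*} [Finite α] [Finite β] (u : α → β)
    {c : ℕ} (h : ∀ b, Nat.card {x // u x = b} = c) : Nat.card α = Nat.card β * c := by
  have := Fintype.ofFinite β
  rw [← Nat.card_congr (Equiv.sigmaFiberEquiv u), Nat.card_sigma]
  simp [h]

theorem exists_ringHom_algebraMap_eq {F K : Type*} [Field F] [Field K] [Algebra F K] [Finite K]
    (σ : F →+* K) : ∃ τ : K →+* K, ∀ c, τ (algebraMap F K c) = σ c := by
  have := Finite.of_injective _ (algebraMap F K).injective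
  have key : @finrank F K _ _ Algebra.toModule = @finrank F K _ _ σ.toAlgebra.toModule := by
    refine Nat.pow_right_injective (Finite.one_lt_card (α := F)) ?_
    change Nat.card F ^ _ = Nat.card F ^ _
    rw [← Module.natCard_eq_pow_finrank,
      ← @Module.natCard_eq_pow_finrank F K _ _ σ.toAlgebra.toModule]
  obtain ⟨τ⟩ := @FiniteField.nonempty_algHom_of_finrank_dvd F K K _ _ _ _ σ.toAlgebra _
    key.dvd
  exact ⟨@AlgHom.toRingHom F K K _ _ _ _ σ.toAlgebra τ,
    fun c => @AlgHom.commutes F K K _ _ _ _ σ.toAlgebra τ c⟩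

theorem nonempty_algebra_of_card_eq_pow {F : Type*} [Field F] [Finite F] (K : Type*)
    [Field K] [Finite K] {a : ℕ} (ha : a ≠ 0) (hK : Nat.card K = Nat.card F ^ a) :
    Nonempty (Algebra F K) := by
  obtain ⟨p, hp⟩ := CharP.exists F
  have : NeZero a := ⟨ha⟩
  have : Fact p.Prime := ⟨CharP.char_is_prime F p⟩
  have := Fintype.ofFinite K
  have := Fintype.ofFinite (FiniteField.Extension F p a)
  have e : FiniteField.Extension F p a ≃+* K := FiniteField.ringEquivOfCardEq <| by
    rw [← Nat.card_eq_fintype_card, ← Nat.card_eq_fintype_card, hK,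
      FiniteField.natCard_extension]
  exact ⟨(e.toRingHom.comp (algebraMap F _)).toAlgebra⟩

section CompatibleModule

theorem exists_module_eq_lsmul {F K V : Type*} [Field F] [Field K] [Algebra F K] [AddCommGroup V]
    [Module F V] (g : K →ₐ[F] End F V) :
    ∃ (_ : Module K V) (_ : IsScalarTower F K V), g = Algebra.lsmul F F V := by
  let : Module K V := Module.compHom V g.toRingHom
  have smul_def (k : K) (v : V) : k • v = g k v := rfl
  exact ⟨inferInstance, ⟨fun c k v => by simp [smul_def]⟩, AlgHom.ext fun _ => rfl⟩

variable (F K V : Type*) [Field F] [Field K] [Algebra F K] [AddCommGroup V] [Module F V]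
  [Module K V] [IsScalarTower F K V]

/-- Forgetting `K`-linearity down to `F`-linearity, as a ring homomorphism. -/
def endRestrictScalars : End K V →+* End F V where
  toFun x := x.restrictScalars F
  map_one' := rfl
  map_mul' _ _ := rfl
  map_zero' := rfl
  map_add' _ _ := rfl

theorem endRestrictScalars_injective : Function.Injective (endRestrictScalars F K V) :=
  LinearMap.restrictScalars_injective F

theorem centralizer_range_lsmul :
    Set.centralizer (Set.range (Algebra.lsmul F F V : K →ₐ[F] End F V)) =
      Set.range (endRestrictScalars F K V) := by
  ext x
  constructor
  · intro hx
    refine ⟨{ x with map_smul' := fun k v => ?_ }, rfl⟩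
    exact (LinearMap.congr_fun (hx _ ⟨k, rfl⟩) v).symm
  · rintro ⟨y, rfl⟩ _ ⟨k, rfl⟩
    ext v
    exact (y.map_smul k v).symm

theorem centralizer_centralizer_range_lsmul :
    Set.centralizer (Set.centralizer (Set.range (Algebra.lsmul F F V : K →ₐ[F] End F V))) =
      Set.range (Algebra.lsmul F F V : K →ₐ[F] End F V) := by
  refine Set.Subset.antisymm (fun x hx => ?_) Set.subset_centralizer_centralizer
  have hcomm : Set.range (Algebra.lsmul F F V : K →ₐ[F] End F V) ⊆
      Set.centralizer (Set.range (Algebra.lsmul F F V : K →ₐ[F] End F V)) := by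
    rintro _ ⟨k, rfl⟩ _ ⟨l, rfl⟩
    rw [← map_mul, ← map_mul, mul_comm]
  have hx' := Set.centralizer_subset hcomm hx
  rw [centralizer_range_lsmul] at hx hx'
  obtain ⟨y, rfl⟩ := hx'
  have hy : y ∈ Subalgebra.center K (End K V) := Subalgebra.mem_center_iff.2 fun z =>
    endRestrictScalars_injective F K V (hx _ ⟨z, rfl⟩)
  obtain ⟨k, -, rfl⟩ := Module.End.mem_subalgebraCenter_iff.1 hy
  exact ⟨k, rfl⟩

end CompatibleModule

section Embeddings

theorem finrank_eq_of_natCard_eq_pow {K V : Type*} [Field K] [Finite K] [AddCommGroup V]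
    [Module K V] [Finite V] {m : ℕ} (hV : Nat.card V = Nat.card K ^ m) : finrank K V = m :=
  Nat.pow_right_injective (Finite.one_lt_card (α := K)) <| by
    simpa [hV] using (Module.natCard_eq_pow_finrank (K := K) (V := V)).symm

variable {F K V : Type*} [Field F] [Field K] [Finite K] [AddCommGroup V] [Module F V]
  [Finite V] {m : ℕ}

theorem exists_ringHom_range_eq_centralizer [Algebra F K] (hV : Nat.card V = Nat.card K ^ m)
    (g : K →ₐ[F] End F V) :
    ∃ f : Matrix (Fin m) (Fin m) K →+* End F V, Function.Injective f ∧
      Set.centralizer (Set.range g) = Set.range f := by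
  obtain ⟨_, _, rfl⟩ := exists_module_eq_lsmul g
  let e := LinearMap.toMatrixAlgEquiv
    (Module.finBasisOfFinrankEq K V (finrank_eq_of_natCard_eq_pow hV))
  refine ⟨(endRestrictScalars F K V).comp e.symm.toRingEquiv.toRingHom,
    (endRestrictScalars_injective F K V).comp e.symm.injective, ?_⟩
  rw [centralizer_range_lsmul]
  exact (e.symm.surjective.range_comp _).symm

theorem exists_ringHom_scalar_eq_smul [NeZero m] (hV : Nat.card V = Nat.card K ^ m)
    (f : Matrix (Fin m) (Fin m) K →+* End F V) (hf : Function.Injective f) :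
    ∃ σ : F →+* K, ∀ c, f (Matrix.scalar (Fin m) (σ c)) = algebraMap F (End F V) c := by
  let h : K →+* End F V := f.comp (Matrix.scalar (Fin m))
  let : Module K V := Module.compHom V h
  let f' : Matrix (Fin m) (Fin m) K → End K V := fun A =>
    { toFun := f A
      map_add' := map_add _
      map_smul' := fun k v => by
        change f A (f (Matrix.scalar (Fin m) k) v) = f (Matrix.scalar (Fin m) k) (f A v)
        rw [← Module.End.mul_apply, ← Module.End.mul_apply, ← map_mul, ← map_mul,
          (Matrix.scalar_commute k (Commute.all k) A).eq] }
  have hf' : Function.Bijective f' := by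
    have : Finite (End K V) := Finite.of_injective (fun x => (x : V → V)) DFunLike.coe_injective
    refine (Nat.bijective_iff_injective_and_card f').2 ⟨fun A B hAB => hf ?_, ?_⟩
    · ext v
      exact LinearMap.congr_fun hAB v
    · exact Nat.card_congr (LinearMap.toMatrix
        (Module.finBasisOfFinrankEq K V (finrank_eq_of_natCard_eq_pow hV))
        (Module.finBasisOfFinrankEq K V (finrank_eq_of_natCard_eq_pow hV))).symm.toEquiv
  have key (c : F) : ∃ k, h k = algebraMap F (End F V) c := by
    obtain ⟨A, hA⟩ := hf'.2
      { toFun := fun v => c • v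
        map_add' := smul_add c
        map_smul' := fun k v => ((h k).map_smul c v).symm }
    have hA' : f A = algebraMap F (End F V) c := LinearMap.ext fun v => LinearMap.congr_fun hA v
    have hc : A ∈ Set.center (Matrix (Fin m) (Fin m) K) :=
      Semigroup.mem_center_iff.2 fun B => hf <| by
        rw [map_mul, map_mul, hA', Algebra.commutes]
    rw [Matrix.center_eq_range] at hc
    obtain ⟨k, rfl⟩ := hc
    exact ⟨k, hA'⟩
  have : Nonempty (Fin m) := ⟨0⟩
  have : Nontrivial (End F V) := hf.nontrivial
  have hinj : Function.Injective h := h.injective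
  choose s hs using key
  refine ⟨⟨⟨⟨s, ?_⟩, ?_⟩, ?_, ?_⟩, hs⟩ <;> intros <;> apply hinj <;> simp [hs]

theorem exists_algHom_centralizer_eq_range [Algebra F K] [NeZero m]
    (hV : Nat.card V = Nat.card K ^ m)
    (f : Matrix (Fin m) (Fin m) K →+* End F V) (hf : Function.Injective f) :
    ∃ g : K →ₐ[F] End F V, Set.centralizer (Set.range g) = Set.range f := by
  obtain ⟨σ, hσ⟩ := exists_ringHom_scalar_eq_smul hV f hf
  obtain ⟨τ, hτ⟩ := exists_ringHom_algebraMap_eq σ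
  let g : K →ₐ[F] End F V :=
    { (f.comp (Matrix.scalar (Fin m))).comp τ with
      commutes' := fun c => by
        change f (Matrix.scalar (Fin m) (τ (algebraMap F K c))) = _
        rw [hτ, hσ] }
  refine ⟨g, ?_⟩
  obtain ⟨f₂, hf₂, hrange⟩ := exists_ringHom_range_eq_centralizer hV g
  have : Finite (End F V) := Finite.of_injective (fun x => (x : V → V)) DFunLike.coe_injective
  refine (Set.eq_of_subset_of_ncard_le ?_ ?_ (Set.toFinite _)).symm
  · rintro _ ⟨A, rfl⟩ _ ⟨k, rfl⟩
    change f (Matrix.scalar (Fin m) (τ k)) * f A = f A * f (Matrix.scalar (Fin m) (τ k))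
    rw [← map_mul, ← map_mul, (Matrix.scalar_commute (τ k) (Commute.all _) A).eq]
  · rw [hrange, ← Set.image_univ, ← Set.image_univ, Set.ncard_image_of_injective _ hf,
      Set.ncard_image_of_injective _ hf₂]

end Embeddings

section Counting

variable {F K V : Type*} [Field F] [Field K] [Algebra F K] [AddCommGroup V] [Module F V]

theorem range_eq_of_centralizer_range_eq {g g' : K →ₐ[F] End F V}
    (h : Set.centralizer (Set.range g) = Set.centralizer (Set.range g')) :
    Set.range g = Set.range g' := by
  have key (g : K →ₐ[F] End F V) :
      Set.centralizer (Set.centralizer (Set.range g)) = Set.range g := by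
    obtain ⟨_, _, rfl⟩ := exists_module_eq_lsmul g
    exact centralizer_centralizer_range_lsmul F K V
  rw [← key g, h, key g']

theorem card_algHom_centralizer_range_eq [Finite K] [Nontrivial V] (g : K →ₐ[F] End F V) :
    Nat.card {g' : K →ₐ[F] End F V //
      Set.centralizer (Set.range g') = Set.centralizer (Set.range g)} = finrank F K := by
  rw [← FiniteField.natCard_algHom_of_finrank_dvd (dvd_refl (finrank F K))]
  have hg : Function.Injective g := g.toRingHom.injective
  symm
  refine Nat.card_eq_of_bijective (fun σ => ⟨g.comp σ, ?_⟩) ⟨fun σ τ h => ?_, ?_⟩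
  · have hσ : Function.Surjective σ := Finite.surjective_of_injective σ.toRingHom.injective
    rw [AlgHom.coe_comp, hσ.range_comp]
  · ext k
    exact hg (DFunLike.congr_fun (Subtype.ext_iff.1 h) k)
  · rintro ⟨g', hg'⟩
    have hr := range_eq_of_centralizer_range_eq hg'
    have hmem (k : K) : g' k ∈ g.range := by
      change g' k ∈ Set.range g
      exact hr ▸ ⟨k, rfl⟩
    refine ⟨(AlgEquiv.ofInjective g hg).symm.toAlgHom.comp (g'.codRestrict g.range hmem),
      Subtype.ext (AlgHom.ext fun k => ?_)⟩
    exact congrArg Subtype.val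
      ((AlgEquiv.ofInjective g hg).apply_symm_apply (g'.codRestrict g.range hmem k))

theorem card_linearEquiv_eq_card_GL {R M : Type*} [CommRing R] [AddCommGroup M] [Module R M]
    {ι : Type*} [Fintype ι] [DecidableEq ι] {N : Type*} [AddCommGroup N] [Module R N]
    (b : Basis ι R M) (b' : Basis ι R N) : Nat.card (M ≃ₗ[R] N) = Nat.card (GL ι R) := by
  have e : M ≃ₗ[R] N := b.equiv b' (Equiv.refl ι)
  rw [Nat.card_congr (Matrix.GeneralLinearGroup.toLin' b).toEquiv,
    Nat.card_congr (LinearMap.GeneralLinearGroup.generalLinearEquiv R M).toEquiv]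
  exact Nat.card_congr
    { toFun := fun φ => φ.trans e.symm
      invFun := fun φ => φ.trans e
      left_inv := fun φ => by ext; simp
      right_inv := fun φ => by ext; simp }

variable [Finite K] [Finite V] {m : ℕ}

theorem card_linearEquiv_conj_lsmul_eq (hV : Nat.card V = Nat.card K ^ m)
    (g : K →ₐ[F] End F V) :
    Nat.card {φ : (Fin m → K) ≃ₗ[F] V //
      (φ.conjAlgEquiv F).toAlgHom.comp (Algebra.lsmul F F (Fin m → K)) = g} =
      Nat.card (GL (Fin m) K) := by
  obtain ⟨_, _, rfl⟩ := exists_module_eq_lsmul g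
  rw [← card_linearEquiv_eq_card_GL (Pi.basisFun K (Fin m))
    (Module.finBasisOfFinrankEq K V (finrank_eq_of_natCard_eq_pow hV))]
  refine Nat.card_congr
    { toFun := fun φ => { φ.1 with map_smul' := fun k w => ?_ }
      invFun := fun ψ => ⟨ψ.restrictScalars F, ?_⟩
      left_inv := fun φ => rfl
      right_inv := fun ψ => rfl }
  · have := LinearMap.congr_fun (DFunLike.congr_fun φ.2 k) (φ.1 w)
    simpa using this
  · ext k v
    simp

theorem card_algHom_mul_card_GL {ι : Type*} [Fintype ι] [DecidableEq ι] (b : Basis ι F V)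
    (hV : Nat.card V = Nat.card K ^ m) :
    Nat.card (K →ₐ[F] End F V) * Nat.card (GL (Fin m) K) = Nat.card (GL ι F) := by
  have := Finite.of_injective _ (algebraMap F K).injective
  have : Finite (End F V) := Finite.of_injective (fun x => (x : V → V)) DFunLike.coe_injective
  have : Finite (K →ₐ[F] End F V) :=
    Finite.of_injective (fun x => (x : K → End F V)) DFunLike.coe_injective
  have : Finite ((Fin m → K) ≃ₗ[F] V) :=
    Finite.of_injective (fun x => (x : (Fin m → K) → V)) DFunLike.coe_injective
  have hcard : finrank F (Fin m → K) = finrank F V :=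
    finrank_eq_of_natCard_eq_pow <| by
      rw [← Module.natCard_eq_pow_finrank (K := F) (V := V), hV]
      simp [Nat.card_fun]
  have e : (Fin m → K) ≃ₗ[F] V := LinearEquiv.ofFinrankEq _ _ hcard
  rw [← card_linearEquiv_eq_card_GL (b.map e.symm) b]
  exact (Nat.card_eq_card_mul_of_card_fiber_eq
    (fun φ : (Fin m → K) ≃ₗ[F] V =>
      (φ.conjAlgEquiv F).toAlgHom.comp (Algebra.lsmul F F (Fin m → K)))
    (card_linearEquiv_conj_lsmul_eq hV)).symm

theorem card_algHom_eq_card_ranges_mul_finrank [NeZero m] [Nontrivial V]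
    (hV : Nat.card V = Nat.card K ^ m) :
    Nat.card (K →ₐ[F] End F V) =
      Nat.card {S : Set (End F V) // ∃ f : Matrix (Fin m) (Fin m) K →+* End F V,
        Function.Injective f ∧ S = Set.range f} * finrank F K := by
  have : Finite (End F V) := Finite.of_injective (fun x => (x : V → V)) DFunLike.coe_injective
  have : Finite (K →ₐ[F] End F V) :=
    Finite.of_injective (fun x => (x : K → End F V)) DFunLike.coe_injective
  refine Nat.card_eq_card_mul_of_card_fiber_eq
    (fun g => ⟨Set.centralizer (Set.range g), exists_ringHom_range_eq_centralizer hV g⟩) ?_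
  rintro ⟨_, f, hf, rfl⟩
  obtain ⟨g, hg⟩ := exists_algHom_centralizer_eq_range hV f hf
  rw [← card_algHom_centralizer_range_eq g, hg]
  exact Nat.card_congr (Equiv.subtypeEquivRight fun _ => Subtype.ext_iff)

end Counting

theorem card_nonUnitalSubring_eq_card_range {A R R' : Type*} [Ring A] [Ring R] [Ring R']
    (e : R ≃+* R') :
    Nat.card {S : NonUnitalSubring R // ∃ f : A →+* R,
        Function.Injective f ∧ (S : Set R) = Set.range f} =
      Nat.card {S : Set R' // ∃ f : A →+* R', Function.Injective f ∧ S = Set.range f} := by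
  refine Nat.card_eq_of_bijective (fun S => ⟨e '' S.1, ?_⟩) ⟨fun S T h => ?_, ?_⟩
  · obtain ⟨f, hf, hS⟩ := S.2
    exact ⟨e.toRingHom.comp f, e.injective.comp hf, by rw [hS]; exact (Set.range_comp e f).symm⟩
  · exact Subtype.ext (SetLike.coe_injective (e.injective.image_injective (Subtype.ext_iff.1 h)))
  · rintro ⟨_, f, hf, rfl⟩
    let f₀ : A →+* R := e.symm.toRingHom.comp f
    refine ⟨⟨f₀.range.toNonUnitalSubring, f₀, e.symm.injective.comp hf, rfl⟩, Subtype.ext ?_⟩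
    change e '' Set.range (e.symm ∘ f) = Set.range f
    have he : e ∘ e.symm = id := funext e.apply_symm_apply
    rw [← Set.range_comp, ← Function.comp_assoc, he, Function.id_comp]


/-- For `n ≥ 2`, a prime divisor `a` of `n`, and a finite field `F` of order
`q`, the number of `GL(n,q)`-conjugates of the subring `M_{n/a}(q^a)` inside
`Mₙ(q)` (i.e. of the ranges of unital ring embeddings of `M_{n/a}(K)` into
`Mₙ(q)`, for `K` a field of order `q^a`) equals
`|GL(n,q)| / (a·|GL(n/a,q^a)|)`; we state this multiplicatively. -/
theorem card_conjugates_of_field_extension_subring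
    (F : Type*) [Field F] [Fintype F] (n a : ℕ) (hn : 2 ≤ n)
    (ha : a.Prime) (han : a ∣ n)
    (K : Type*) [Field K] [Fintype K]
    (hK : Fintype.card K = Fintype.card F ^ a) :
    Nat.card {S : NonUnitalSubring (Matrix (Fin n) (Fin n) F) //
        ∃ f : Matrix (Fin (n / a)) (Fin (n / a)) K →+* Matrix (Fin n) (Fin n) F,
          Function.Injective f ∧
          (S : Set (Matrix (Fin n) (Fin n) F)) = Set.range f} *
      (a * Nat.card (GL (Fin (n / a)) K)) =
      Nat.card (GL (Fin n) F) := by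
  have hm : NeZero (n / a) := ⟨(Nat.div_pos (Nat.le_of_dvd (by omega) han) ha.pos).ne'⟩
  have : Nonempty (Fin n) := ⟨⟨0, by omega⟩⟩
  have hK' : Nat.card K = Nat.card F ^ a := by simpa using hK
  obtain ⟨_⟩ := nonempty_algebra_of_card_eq_pow K ha.ne_zero hK'
  have hV : Nat.card (Fin n → F) = Nat.card K ^ (n / a) := by
    rw [hK', ← pow_mul, Nat.mul_div_cancel' han]
    simp
  rw [card_nonUnitalSubring_eq_card_range
      (Matrix.toLinAlgEquiv' (R := F) (n := Fin n)).toRingEquiv,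
    ← card_algHom_mul_card_GL (Pi.basisFun F (Fin n)) hV,
    card_algHom_eq_card_ranges_mul_finrank hV, finrank_eq_of_natCard_eq_pow hK', mul_assoc]
end

section
/- Let n ≥ 2, q a prime power, b the smallest prime divisor of n, and N(b) the number of subspaces of F_q^n of dimension k with b ∤ k and k ≤ n/2. Then M_n(q) is the union of (1/b)·∏_{1≤i≤n-1, b∤i}(q^n − q^i) + N(b) proper subrings, namely all GL(n,q)-conjugates of M_{n/b}(q^b) together with all stabilizer rings M(U) for subspaces U of dimension k with b ∤ k and k ≤ n/2. Hence σ(M_n(q)) ≤ (1/b)·∏_{1≤i≤n-1, b∤i}(q^n − q^i) + N(b). -/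
/-- `S` is a `GL(n,q)`-conjugate of `M_{n/b}(q^b)` inside `Mₙ(q)`, expressed as
being the range of a unital ring embedding of `M_{n/b}(K)` for a field `K` of
order `q^b`. -/
def IsExtConjugate (F : Type) [Field F] [Fintype F] (n b : ℕ)
    (S : NonUnitalSubring (Matrix (Fin n) (Fin n) F)) : Prop :=
  ∃ (K : Type) (_ : Field K) (_ : Fintype K),
    Fintype.card K = Fintype.card F ^ b ∧
    ∃ f : Matrix (Fin (n / b)) (Fin (n / b)) K →+* Matrix (Fin n) (Fin n) F,
      Function.Injective f ∧ (S : Set (Matrix (Fin n) (Fin n) F)) = Set.range f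

/-- `S` is the stabilizer ring `M(U)` of a subspace `U ≤ F^n` whose dimension
`k` satisfies `b ∤ k` and `k ≤ n/2`, where `b` is the smallest prime divisor
of `n`. -/
def IsSmallStabilizer (F : Type) [Field F] [Fintype F] (n : ℕ)
    (S : NonUnitalSubring (Matrix (Fin n) (Fin n) F)) : Prop :=
  ∃ U : Submodule F (Fin n → F),
    ¬ n.minFac ∣ Module.finrank F U ∧ 2 * Module.finrank F U ≤ n ∧
    (S : Set (Matrix (Fin n) (Fin n) F)) = {m | ∀ v ∈ U, m.mulVec v ∈ U}

section

open Polynomial Module Matrix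

/-- A finite-dimensional commutative algebra over a finite field all of whose residue fields have
degree divisible by `[K : F]` contains a copy of `K`. -/
theorem nonempty_algHom_of_forall_dvd_finrank_quotient {F K A : Type*} [Field F] [Finite F]
    [Field K] [Algebra F K] [FiniteDimensional F K] [CommRing A] [Algebra F A]
    [FiniteDimensional F A]
    (h : ∀ I : Ideal A, I.IsMaximal → finrank F K ∣ finrank F (A ⧸ I)) :
    Nonempty (K →ₐ[F] A) := by
  have : IsArtinianRing A := IsArtinianRing.of_finite F A
  have hφ (I : MaximalSpectrum A) : Nonempty (K →ₐ[F] A ⧸ I.asIdeal) := by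
    have := I.isMaximal
    let := Ideal.Quotient.field I.asIdeal
    have : Finite (A ⧸ I.asIdeal) := Module.finite_of_finite F
    exact FiniteField.nonempty_algHom_of_finrank_dvd (h _ I.isMaximal)
  have : Algebra.FormallyEtale F K := Algebra.FormallyEtale.of_isSeparable F K
  exact ⟨Algebra.FormallySmooth.lift (nilradical A) (IsNoetherianRing.isNilpotent_nilradical A)
    (((IsArtinianRing.quotNilradicalEquivPi A).restrictScalars F).symm.toAlgHom.comp
      (AlgHom.pi fun I ↦ (hφ I).some))⟩

theorem exists_invariant_submodule_finrank_eq_natDegree {F V : Type*} [Field F] [AddCommGroup V]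
    [Module F V] {x : End F V} {p : F[X]} (hp : Irreducible p) {v : V} (hv : v ≠ 0)
    (hpv : aeval x p v = 0) :
    ∃ U : Submodule F V, finrank F U = p.natDegree ∧ ∀ u ∈ U, x u ∈ U := by
  have : Fact (Irreducible p) := ⟨hp⟩
  let g : F[X] →ₗ[F] V := (LinearMap.applyₗ v).comp (aeval x).toLinearMap
  have hg (r : F[X]) : g r = aeval x r v := rfl
  have hle : (Ideal.span {p}).restrictScalars F ≤ LinearMap.ker g := by
    intro r hr
    obtain ⟨s, rfl⟩ := Ideal.mem_span_singleton.1 hr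
    simp [hg, mul_comm p s, hpv]
  have hker : LinearMap.ker g ≤ (Ideal.span {p}).restrictScalars F := by
    intro r hr
    by_contra hr'
    have hcop : IsCoprime p r :=
      (hp.coprime_iff_not_dvd).2 fun h ↦ hr' (Ideal.mem_span_singleton.2 h)
    obtain ⟨a, c, hac⟩ := hcop
    apply hv
    have hrv : aeval x r v = 0 := hr
    have h1 : aeval x (a * p + c * r) v = 0 := by simp [hpv, hrv]
    rw [hac] at h1
    simpa using h1
  refine ⟨LinearMap.range g, ?_, ?_⟩
  · rw [← (LinearMap.quotKerEquivRange g).finrank_eq, le_antisymm hker hle]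
    exact (AdjoinRoot.powerBasis hp.ne_zero).finrank.trans (AdjoinRoot.powerBasis_dim hp.ne_zero)
  · rintro _ ⟨r, rfl⟩
    exact ⟨X * r, by simp [hg]⟩


theorem exists_irreducible_dvd_minpoly_of_isMaximal {F A : Type*} [Field F] [CommRing A]
    [Algebra F A] [FiniteDimensional F A] {a : A} (ha : Algebra.adjoin F {a} = ⊤) (I : Ideal A)
    [I.IsMaximal] :
    ∃ p : F[X], Irreducible p ∧ p ∣ minpoly F a ∧ p.natDegree = finrank F (A ⧸ I) := by
  let := Ideal.Quotient.field I
  have hint : IsIntegral F (Ideal.Quotient.mkₐ F I a) := Algebra.IsIntegral.isIntegral _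
  refine ⟨minpoly F (Ideal.Quotient.mkₐ F I a), minpoly.irreducible hint, ?_, ?_⟩
  · apply minpoly.dvd
    rw [aeval_algHom_apply, minpoly.aeval, map_zero]
  · have htop : Algebra.adjoin F {Ideal.Quotient.mkₐ F I a} = ⊤ := by
      rw [← Set.image_singleton, ← AlgHom.map_adjoin, ha, Algebra.map_top, AlgHom.range_eq_top]
      exact Ideal.Quotient.mkₐ_surjective F I
    exact (PowerBasis.ofAdjoinEqTop' hint htop).finrank.symm

theorem ker_aeval_ne_bot_of_dvd_minpoly {F V : Type*} [Field F] [AddCommGroup V] [Module F V]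
    [FiniteDimensional F V] {x : End F V} {p : F[X]} (hp : Irreducible p) (hpx : p ∣ minpoly F x) :
    LinearMap.ker (aeval x p) ≠ ⊥ := by
  intro hker
  obtain ⟨r, hr⟩ := hpx
  have hx : minpoly F x ≠ 0 := minpoly.ne_zero (Algebra.IsIntegral.isIntegral x)
  have hr0 : r ≠ 0 := by rintro rfl; simp_all
  have hrx : aeval x r = 0 := by
    ext v
    have h : aeval x (p * r) v = 0 := by rw [← hr, minpoly.aeval]; rfl
    rw [map_mul] at h
    exact LinearMap.ker_eq_bot'.1 hker _ h
  have hdeg := natDegree_le_of_dvd (minpoly.dvd F x hrx) hr0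
  rw [hr, natDegree_mul hp.ne_zero hr0] at hdeg
  have := hp.natDegree_pos
  omega

theorem aeval_dualMap {F V : Type*} [Field F] [AddCommGroup V] [Module F V] (x : End F V)
    (p : F[X]) : aeval (R := F) (A := End F (Dual F V)) x.dualMap p = (aeval x p).dualMap := by
  induction p using Polynomial.induction_on' with
  | add p r hp hr => ext; simp [hp, hr]
  | monomial k c =>
    have h : ∀ k : ℕ, (x.dualMap : End F (Dual F V)) ^ k = (x ^ k).dualMap := by
      intro k
      induction k with
      | zero => rfl
      | succ k ih => rw [pow_succ, ih, pow_succ']; rfl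
    ext
    simp [aeval_monomial, h]

theorem exists_invariant_submodules_of_irreducible_dvd_minpoly {F V : Type*} [Field F]
    [AddCommGroup V] [Module F V] [FiniteDimensional F V] {x : End F V} {p : F[X]}
    (hp : Irreducible p) (hpx : p ∣ minpoly F x) :
    (∃ U : Submodule F V, finrank F U = p.natDegree ∧ ∀ u ∈ U, x u ∈ U) ∧
    ∃ U : Submodule F V, p.natDegree + finrank F U = finrank F V ∧ ∀ u ∈ U, x u ∈ U := by
  have hker := ker_aeval_ne_bot_of_dvd_minpoly hp hpx
  constructor
  · obtain ⟨v, hv, hv0⟩ := Submodule.exists_mem_ne_zero_of_ne_bot hker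
    exact exists_invariant_submodule_finrank_eq_natDegree hp hv0 hv
  · have hrange : LinearMap.range (aeval x p) < ⊤ :=
      lt_top_iff_ne_top.2 fun h ↦ hker (LinearMap.ker_eq_bot_iff_range_eq_top.2 h)
    obtain ⟨φ, hφ0, hφ⟩ := Submodule.exists_le_ker_of_lt_top _ hrange
    obtain ⟨U, hU, hxU⟩ := exists_invariant_submodule_finrank_eq_natDegree
      (x := (x.dualMap : End F (Dual F V))) hp hφ0 (by
        rw [aeval_dualMap]
        ext v
        exact hφ ⟨v, rfl⟩)
    refine ⟨U.dualCoannihilator, ?_, fun u hu ↦ ?_⟩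
    · rw [← hU, Subspace.finrank_add_finrank_dualCoannihilator_eq]
    · rw [Submodule.mem_dualCoannihilator] at hu ⊢
      exact fun ψ hψ ↦ hu _ (hxU ψ hψ)

/-- If `[K : F]` divides `dim V`, every endomorphism of `V` either stabilizes a subspace of dimension
at most `dim V / 2` not divisible by `[K : F]`, or commutes with a copy of `K`. -/
theorem exists_invariant_submodule_or_algHom_commute {F V K : Type*} [Field F] [Finite F]
    [Field K] [Algebra F K] [FiniteDimensional F K]
    [AddCommGroup V] [Module F V] [FiniteDimensional F V] (hKV : finrank F K ∣ finrank F V)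
    (x : End F V) :
    (∃ U : Submodule F V, ¬ finrank F K ∣ finrank F U ∧ 2 * finrank F U ≤ finrank F V ∧
      ∀ u ∈ U, x u ∈ U) ∨
    ∃ φ : K →ₐ[F] End F V, ∀ c, Commute (φ c) x := by
  by_cases h : ∃ p : F[X], Irreducible p ∧ p ∣ minpoly F x ∧ ¬ finrank F K ∣ p.natDegree
  · left
    obtain ⟨p, hp, hpx, hdvd⟩ := h
    obtain ⟨⟨U, hU, hxU⟩, W, hW, hxW⟩ :=
      exists_invariant_submodules_of_irreducible_dvd_minpoly hp hpx
    by_cases hle : 2 * finrank F U ≤ finrank F V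
    · exact ⟨U, hU ▸ hdvd, hle, hxU⟩
    · refine ⟨W, fun hdW ↦ hdvd ?_, by omega, hxW⟩
      exact (Nat.dvd_add_left hdW).1 (hW ▸ hKV)
  · right
    push Not at h
    have : IsMulCommutative (Algebra.adjoin F {x}) := Algebra.isMulCommutative_adjoin F (by simp)
    let a : Algebra.adjoin F {x} := ⟨x, Algebra.self_mem_adjoin_singleton F x⟩
    have ha : Algebra.adjoin F {a} = ⊤ := by
      rw [← Algebra.adjoin_adjoin_coe_preimage]
      congr 1
      ext y
      simp [a, Subtype.ext_iff]
    have hmin : minpoly F a = minpoly F x :=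
      (minpoly.algHom_eq (Algebra.adjoin F {x}).val Subtype.val_injective a).symm
    obtain ⟨φ⟩ := nonempty_algHom_of_forall_dvd_finrank_quotient (F := F) (K := K)
      (A := Algebra.adjoin F {x}) fun I hI ↦ by
        obtain ⟨p, hp, hpa, hdeg⟩ := exists_irreducible_dvd_minpoly_of_isMaximal ha I
        exact hdeg ▸ h p hp (hmin ▸ hpa)
    refine ⟨(Algebra.adjoin F {x}).val.comp φ, fun c ↦ ?_⟩
    exact congrArg Subtype.val (mul_comm (φ c) a)

theorem exists_smul_of_forall_map_mulVec {K ι : Type*} [Field K] [Fintype ι] [DecidableEq ι]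
    [Nonempty ι] (T : (ι → K) →+ (ι → K))
    (hT : ∀ (M : Matrix ι ι K) w, T (M *ᵥ w) = M *ᵥ T w) : ∃ t : K, ∀ w, T w = t • w := by
  obtain ⟨i⟩ := ‹Nonempty ι›
  refine ⟨T (Pi.single i 1) i, fun w ↦ ?_⟩
  have h := hT (vecMulVec w (Pi.single i 1)) (Pi.single i 1)
  rwa [vecMulVec_mulVec, vecMulVec_mulVec, single_dotProduct, single_dotProduct, one_mul, one_mul,
    Pi.single_eq_same, MulOpposite.op_one, one_smul, op_smul_eq_smul] at h

section ScalarExtension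

variable {F K : Type*} [Field F] [Field K] [Algebra F K] {m n : ℕ}

/-- The embedding `M_m(K) → M_n(F)` obtained by transporting the action of matrices along an
`F`-linear equivalence `K^m ≃ F^n`. -/
noncomputable def matrixConjHom (e : (Fin m → K) ≃ₗ[F] (Fin n → F)) :
    Matrix (Fin m) (Fin m) K →+* Matrix (Fin n) (Fin n) F :=
  (LinearMap.toMatrixAlgEquiv' (R := F) (n := Fin n)).toRingEquiv.toRingHom.comp
    { toFun := fun M ↦ e.toLinearMap ∘ₗ (M.mulVecLin.restrictScalars F) ∘ₗ e.symm.toLinearMap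
      map_one' := by ext; simp
      map_mul' := fun _ _ ↦ by ext; simp
      map_zero' := by ext; simp
      map_add' := fun _ _ ↦ by ext; simp }

theorem matrixConjHom_mulVec (e : (Fin m → K) ≃ₗ[F] (Fin n → F)) (M : Matrix (Fin m) (Fin m) K)
    (w : Fin m → K) : matrixConjHom e M *ᵥ e w = e (M *ᵥ w) := by
  rw [← Matrix.toLin'_apply]
  simp [matrixConjHom, LinearMap.toMatrixAlgEquiv']

theorem eq_of_forall_mulVec_equiv (e : (Fin m → K) ≃ₗ[F] (Fin n → F))
    {A B : Matrix (Fin n) (Fin n) F} (h : ∀ w, A *ᵥ e w = B *ᵥ e w) : A = B :=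
  Matrix.mulVec_injective (funext fun v ↦ by simpa using h (e.symm v))

theorem matrixConjHom_injective (e : (Fin m → K) ≃ₗ[F] (Fin n → F)) :
    Function.Injective (matrixConjHom e) := by
  intro M N h
  refine Matrix.mulVec_injective (funext fun w ↦ e.injective ?_)
  rw [← matrixConjHom_mulVec, h, matrixConjHom_mulVec]

/-- The `F`-algebra embedding `K → M_n(F)` given by scalar multiplication on `K^m ≃ F^n`. -/
noncomputable def scalarConjHom (e : (Fin m → K) ≃ₗ[F] (Fin n → F)) :
    K →ₐ[F] Matrix (Fin n) (Fin n) F :=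
  { (matrixConjHom e).comp (Matrix.scalar (Fin m)) with
    commutes' := fun a ↦ eq_of_forall_mulVec_equiv e fun w ↦ by
      simp [matrixConjHom_mulVec, Algebra.algebraMap_eq_smul_one, ← Matrix.smul_one_eq_diagonal,
        smul_mulVec] }

theorem scalarConjHom_mulVec (e : (Fin m → K) ≃ₗ[F] (Fin n → F)) (c : K) (w : Fin m → K) :
    scalarConjHom e c *ᵥ e w = e (c • w) :=
  (matrixConjHom_mulVec e _ w).trans (by simp [Matrix.scalar_apply, ← Matrix.smul_one_eq_diagonal,
        smul_mulVec])

theorem scalarConjHom_eq_iff (e : (Fin m → K) ≃ₗ[F] (Fin n → F))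
    (φ : K →ₐ[F] Matrix (Fin n) (Fin n) F) :
    scalarConjHom e = φ ↔ ∀ c w, e (c • w) = φ c *ᵥ e w := by
  constructor
  · rintro rfl c w
    exact (scalarConjHom_mulVec e c w).symm
  · intro h
    ext1 c
    exact eq_of_forall_mulVec_equiv e fun w ↦ by rw [scalarConjHom_mulVec, h]

theorem range_matrixConjHom (e : (Fin m → K) ≃ₗ[F] (Fin n → F)) :
    Set.range (matrixConjHom e) = Set.centralizer (Set.range (scalarConjHom e)) := by
  ext y
  simp only [Set.mem_centralizer_iff, Set.forall_mem_range]
  constructor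
  · rintro ⟨M, rfl⟩ c
    refine eq_of_forall_mulVec_equiv e fun w ↦ ?_
    simp only [← mulVec_mulVec, matrixConjHom_mulVec, scalarConjHom_mulVec, mulVec_smul]
  · intro hy
    let L : (Fin m → K) →ₗ[K] (Fin m → K) :=
      { toFun := fun w ↦ e.symm (y *ᵥ e w)
        map_add' := fun _ _ ↦ by simp [mulVec_add]
        map_smul' := fun c w ↦ by
          rw [LinearEquiv.symm_apply_eq]
          simp only [RingHom.id_apply]
          rw [← scalarConjHom_mulVec, ← scalarConjHom_mulVec, e.apply_symm_apply, mulVec_mulVec,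
            mulVec_mulVec, hy] }
    refine ⟨LinearMap.toMatrix' L, eq_of_forall_mulVec_equiv e fun w ↦ ?_⟩
    rw [matrixConjHom_mulVec, LinearMap.toMatrix'_mulVec]
    exact e.apply_symm_apply _

theorem exists_scalarConjHom_eq [FiniteDimensional F K] (hn : n = finrank F K * m)
    (φ : K →ₐ[F] Matrix (Fin n) (Fin n) F) :
    ∃ e : (Fin m → K) ≃ₗ[F] (Fin n → F), scalarConjHom e = φ := by
  let ψ : K →ₐ[F] End F (Fin n → F) := (Matrix.toLinAlgEquiv' (R := F) (n := Fin n)).toAlgHom.comp φ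
  let : Module K (Fin n → F) := Module.compHom _ ψ.toRingHom
  have hsmul (c : K) (v : Fin n → F) : c • v = φ c *ᵥ v := rfl
  have : IsScalarTower F K (Fin n → F) := ⟨fun a c v ↦ by
    rw [hsmul, hsmul, map_smul, smul_mulVec]⟩
  have : FiniteDimensional K (Fin n → F) := FiniteDimensional.right F K _
  have hrank := Module.finrank_mul_finrank F K (Fin n → F)
  rw [finrank_fin_fun] at hrank
  have hm : finrank K (Fin m → K) = finrank K (Fin n → F) := by
    rw [finrank_fin_fun]
    exact (Nat.eq_of_mul_eq_mul_left finrank_pos (hrank.trans hn)).symm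
  let e := LinearEquiv.ofFinrankEq _ _ hm
  exact ⟨e.restrictScalars F, (scalarConjHom_eq_iff _ _).2 fun c w ↦ e.map_smul c w⟩

theorem centralizer_centralizer_range [FiniteDimensional F K] (hm : m ≠ 0)
    (hn : n = finrank F K * m) (φ : K →ₐ[F] Matrix (Fin n) (Fin n) F) :
    Set.centralizer (Set.centralizer (Set.range φ)) = Set.range φ := by
  obtain ⟨e, rfl⟩ := exists_scalarConjHom_eq hn φ
  have : Nonempty (Fin m) := ⟨0, Nat.pos_of_ne_zero hm⟩
  refine Set.Subset.antisymm (fun y hy ↦ ?_) Set.subset_centralizer_centralizer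
  rw [← range_matrixConjHom, Set.mem_centralizer_iff, Set.forall_mem_range] at hy
  let T : (Fin m → K) →+ (Fin m → K) :=
    { toFun := fun w ↦ e.symm (y *ᵥ e w)
      map_zero' := by simp
      map_add' := fun _ _ ↦ by simp [mulVec_add] }
  obtain ⟨t, ht⟩ := exists_smul_of_forall_map_mulVec T fun M w ↦ by
    apply e.injective
    rw [← matrixConjHom_mulVec]
    simp only [T, AddMonoidHom.coe_mk, ZeroHom.coe_mk, e.apply_symm_apply]
    rw [← matrixConjHom_mulVec, mulVec_mulVec, mulVec_mulVec, hy]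
  refine ⟨t, eq_of_forall_mulVec_equiv e fun w ↦ ?_⟩
  rw [scalarConjHom_mulVec, ← ht]
  exact e.apply_symm_apply _

end ScalarExtension

section RingEmbedding

theorem exists_addEquiv_of_ringHom_matrix {F K : Type*} [Field F] [Field K] [Fintype F]
    [Fintype K] {m n : ℕ} (hm : m ≠ 0) (hcard : Fintype.card K ^ m = Fintype.card F ^ n)
    (f : Matrix (Fin m) (Fin m) K →+* Matrix (Fin n) (Fin n) F) (hf : Function.Injective f) :
    ∃ e : (Fin m → K) ≃+ (Fin n → F), ∀ M w, f M *ᵥ e w = e (M *ᵥ w) := by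
  let i : Fin m := ⟨0, Nat.pos_of_ne_zero hm⟩
  obtain ⟨v, hv⟩ : ∃ v, f (vecMulVec (Pi.single i 1) (Pi.single i 1)) *ᵥ v ≠ 0 := by
    by_contra! h
    have h0 : f (vecMulVec (Pi.single i 1) (Pi.single i 1)) = 0 :=
      Matrix.mulVec_injective (funext fun v ↦ by simp [h])
    rw [map_eq_zero_iff f hf] at h0
    simpa [vecMulVec_apply] using congrFun₂ h0 i i
  let g : (Fin m → K) →+ (Fin n → F) :=
    { toFun := fun a ↦ f (vecMulVec a (Pi.single i 1)) *ᵥ v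
      map_zero' := by simp
      map_add' := fun _ _ ↦ by simp [add_vecMulVec, add_mulVec] }
  have hg (M : Matrix (Fin m) (Fin m) K) (w : Fin m → K) : f M *ᵥ g w = g (M *ᵥ w) := by
    simp [g, mulVec_mulVec, ← map_mul, mul_vecMulVec]
  have hinj : Function.Injective g := by
    rw [injective_iff_map_eq_zero]
    intro a ha
    by_contra hne
    obtain ⟨j, hj⟩ := Function.ne_iff.1 hne
    have h := hg (vecMulVec (Pi.single i 1) (Pi.single j (a j)⁻¹)) a
    rw [ha, mulVec_zero, vecMulVec_mulVec] at h
    apply hv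
    have hj' : a j ≠ 0 := hj
    simpa [hj', g] using h.symm
  have hbij : Function.Bijective g :=
    (Fintype.bijective_iff_injective_and_card g).2 ⟨hinj, by simp [hcard]⟩
  exact ⟨AddEquiv.ofBijective g hbij, hg⟩

theorem exists_algebra_range_eq_centralizer {F K : Type*} [Field F] [Field K] [Fintype F]
    [Fintype K] {m n : ℕ} (hm : m ≠ 0) (hcard : Fintype.card K ^ m = Fintype.card F ^ n)
    (f : Matrix (Fin m) (Fin m) K →+* Matrix (Fin n) (Fin n) F) (hf : Function.Injective f) :
    ∃ (_ : Algebra F K) (φ : K →ₐ[F] Matrix (Fin n) (Fin n) F),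
      Set.range f = Set.centralizer (Set.range φ) := by
  obtain ⟨e, he⟩ := exists_addEquiv_of_ringHom_matrix hm hcard f hf
  have : Nonempty (Fin m) := ⟨0, Nat.pos_of_ne_zero hm⟩
  have key (a : F) : ∃ t : K, ∀ w, e (t • w) = a • e w := by
    let T : (Fin m → K) →+ (Fin m → K) :=
      { toFun := fun w ↦ e.symm (a • e w)
        map_zero' := by simp
        map_add' := fun _ _ ↦ by simp }
    obtain ⟨t, ht⟩ := exists_smul_of_forall_map_mulVec T fun M w ↦ by
      apply e.injective
      rw [← he]
      simp only [T, AddMonoidHom.coe_mk, ZeroHom.coe_mk, e.apply_symm_apply]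
      rw [← he, mulVec_smul]
    refine ⟨t, fun w ↦ ?_⟩
    rw [← ht]
    exact e.apply_symm_apply _
  choose j hj using key
  have huniq {s t : K} (h : ∀ w, e (s • w) = e (t • w)) : s = t := by
    simpa using congrFun (e.injective (h 1)) (Classical.arbitrary _)
  let jhom : F →+* K :=
    { toFun := j
      map_one' := huniq fun w ↦ by simp [hj]
      map_mul' := fun a b ↦ huniq fun w ↦ by simp [hj, mul_smul]
      map_zero' := huniq fun w ↦ by simp [hj]
      map_add' := fun a b ↦ huniq fun w ↦ by simp [hj, add_smul] }
  let : Algebra F K := jhom.toAlgebra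
  let e' : (Fin m → K) ≃ₗ[F] (Fin n → F) :=
    { e with map_smul' := fun a w ↦ hj a w }
  refine ⟨inferInstance, scalarConjHom e', ?_⟩
  rw [← range_matrixConjHom]
  have : f = matrixConjHom e' := by
    ext1 M
    exact eq_of_forall_mulVec_equiv e' fun w ↦ by rw [matrixConjHom_mulVec]; exact he M w
  rw [this]

end RingEmbedding

section Counting

theorem Nat.card_eq_card_mul_of_forall_card_fiber {α β : Type*} [Finite α] [Finite β] (f : α → β)
    {c : ℕ} (h : ∀ y, Nat.card {x // f x = y} = c) : Nat.card α = Nat.card β * c := by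
  have := Fintype.ofFinite β
  rw [Nat.card_congr (Equiv.sigmaFiberEquiv f).symm, Nat.card_sigma]
  simp [h, Nat.card_eq_fintype_card]

theorem card_linearEquiv_fin_fun (K : Type*) [Field K] [Fintype K] (m : ℕ) :
    Nat.card ((Fin m → K) ≃ₗ[K] (Fin m → K)) =
      ∏ i ∈ Finset.range m, (Fintype.card K ^ m - Fintype.card K ^ i) := by
  rw [← Nat.card_congr (LinearMap.GeneralLinearGroup.generalLinearEquiv K (Fin m → K)).toEquiv,
    ← Nat.card_congr (Matrix.GeneralLinearGroup.toLin (n := Fin m) (R := K)).toEquiv,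
    Matrix.card_GL_field, Finset.prod_range]

theorem card_fiber_scalarConjHom {F K : Type*} [Field F] [Field K] [Algebra F K] {m n : ℕ}
    (e₀ : (Fin m → K) ≃ₗ[F] (Fin n → F)) :
    Nat.card {e : (Fin m → K) ≃ₗ[F] (Fin n → F) // scalarConjHom e = scalarConjHom e₀} =
      Nat.card ((Fin m → K) ≃ₗ[K] (Fin m → K)) := by
  symm
  refine Nat.card_eq_of_bijective
    (fun g ↦ ⟨(g.restrictScalars F).trans e₀, ?_⟩) ⟨fun g g' h ↦ ?_, fun ⟨e, he⟩ ↦ ?_⟩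
  · rw [scalarConjHom_eq_iff]
    intro c w
    simp [scalarConjHom_mulVec]
  · ext1 w
    exact e₀.injective (LinearEquiv.congr_fun (congrArg Subtype.val h) w)
  · rw [scalarConjHom_eq_iff] at he
    let g : (Fin m → K) ≃ₗ[K] (Fin m → K) :=
      { e.trans e₀.symm with
        map_smul' := fun c w ↦ by
          apply e₀.injective
          simp [he, ← scalarConjHom_mulVec] }
    refine ⟨g, Subtype.ext (LinearEquiv.ext fun w ↦ ?_)⟩
    exact e₀.apply_symm_apply _

variable {F K : Type*} [Field F] [Fintype F] [Field K] [Algebra F K] [FiniteDimensional F K]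
  {m n : ℕ}

theorem card_algHom_fiber_range (φ₀ : K →ₐ[F] Matrix (Fin n) (Fin n) F) (hn : n ≠ 0) :
    Nat.card {φ : K →ₐ[F] Matrix (Fin n) (Fin n) F // Set.range φ = Set.range φ₀} =
      finrank F K := by
  have : Nonempty (Fin n) := ⟨0, Nat.pos_of_ne_zero hn⟩
  have hinj : Function.Injective φ₀ := φ₀.toRingHom.injective
  have : Finite K := Module.finite_of_finite F
  rw [← FiniteField.natCard_algHom_of_finrank_dvd (F := F) (K := K) (L := K) dvd_rfl]
  symm
  refine Nat.card_eq_of_bijective (fun σ ↦ ⟨φ₀.comp σ, ?_⟩) ⟨fun σ τ h ↦ ?_, fun ⟨φ, hφ⟩ ↦ ?_⟩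
  · have hσ : Function.Surjective σ := (Algebra.IsAlgebraic.algHom_bijective σ).2
    rw [AlgHom.coe_comp, hσ.range_comp]
  · ext1 c
    exact hinj (DFunLike.congr_fun (congrArg Subtype.val h) c)
  · have hmem (c : K) : φ c ∈ φ₀.range := hφ.subset (Set.mem_range_self c)
    refine ⟨(AlgEquiv.ofInjective φ₀ hinj).symm.toAlgHom.comp (φ.codRestrict φ₀.range hmem),
      Subtype.ext (AlgHom.ext fun c ↦ ?_)⟩
    exact congrArg Subtype.val
      ((AlgEquiv.ofInjective φ₀ hinj).apply_symm_apply (φ.codRestrict φ₀.range hmem c))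

theorem prod_range_filter_dvd (q b m : ℕ) (hb : b ≠ 0) :
    ∏ i ∈ (Finset.range (b * m)).filter (fun i ↦ b ∣ i), (q ^ (b * m) - q ^ i) =
      ∏ j ∈ Finset.range m, ((q ^ b) ^ m - (q ^ b) ^ j) := by
  have : (Finset.range (b * m)).filter (fun i ↦ b ∣ i) = (Finset.range m).image (b * ·) := by
    ext i
    simp only [Finset.mem_filter, Finset.mem_range, Finset.mem_image]
    constructor
    · rintro ⟨hi, j, rfl⟩
      exact ⟨j, lt_of_mul_lt_mul_left' hi, rfl⟩
    · rintro ⟨j, hj, rfl⟩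
      exact ⟨Nat.mul_lt_mul_of_pos_left hj (Nat.pos_of_ne_zero hb), dvd_mul_right _ _⟩
  rw [this, Finset.prod_image fun _ _ _ _ h ↦ Nat.eq_of_mul_eq_mul_left (Nat.pos_of_ne_zero hb) h]
  simp [pow_mul]

theorem card_algHom_matrix (hn : n = finrank F K * m) :
    Nat.card (K →ₐ[F] Matrix (Fin n) (Fin n) F) =
      ∏ i ∈ (Finset.range n).filter (fun i ↦ ¬ finrank F K ∣ i),
        (Fintype.card F ^ n - Fintype.card F ^ i) := by
  have : Finite K := Module.finite_of_finite F
  have := Fintype.ofFinite K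
  have hrank : finrank F (Fin n → F) = finrank F (Fin m → K) := by
    rw [finrank_fin_fun, hn, ← Module.finrank_mul_finrank F K (Fin m → K), finrank_fin_fun]
  let e₀ := LinearEquiv.ofFinrankEq _ _ hrank
  have hE : Nat.card ((Fin m → K) ≃ₗ[F] (Fin n → F)) =
      Nat.card ((Fin n → F) ≃ₗ[F] (Fin n → F)) :=
    Nat.card_congr ⟨fun e ↦ e₀.trans e, fun e ↦ e₀.symm.trans e, fun e ↦ by ext; simp,
      fun e ↦ by ext1; simp⟩
  have : Finite (K →ₐ[F] Matrix (Fin n) (Fin n) F) :=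
    Finite.of_injective (fun φ ↦ (φ : K → Matrix (Fin n) (Fin n) F)) DFunLike.coe_injective
  have : Finite ((Fin m → K) ≃ₗ[F] (Fin n → F)) :=
    Finite.of_injective (fun e ↦ (e : (Fin m → K) → (Fin n → F))) DFunLike.coe_injective
  have h := Nat.card_eq_card_mul_of_forall_card_fiber
    (scalarConjHom : ((Fin m → K) ≃ₗ[F] (Fin n → F)) → _)
    (c := Nat.card ((Fin m → K) ≃ₗ[K] (Fin m → K))) fun φ ↦ by
      obtain ⟨e, rfl⟩ := exists_scalarConjHom_eq hn φ
      exact card_fiber_scalarConjHom e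
  have hpos : 0 < Nat.card ((Fin m → K) ≃ₗ[K] (Fin m → K)) := by
    have : Finite ((Fin m → K) ≃ₗ[K] (Fin m → K)) :=
      Finite.of_injective (fun e ↦ (e : (Fin m → K) → (Fin m → K))) DFunLike.coe_injective
    exact Nat.card_pos
  refine Nat.eq_of_mul_eq_mul_right hpos ?_
  rw [← h, hE, card_linearEquiv_fin_fun, card_linearEquiv_fin_fun,
    ← Finset.prod_filter_mul_prod_filter_not _ (fun i ↦ ¬ finrank F K ∣ i)]
  congr 1
  simp only [not_not]
  rw [Module.card_eq_pow_finrank (K := F) (V := K), ← prod_range_filter_dvd _ _ _ finrank_pos.ne',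
    ← hn]

end Counting

section Stabilizer

theorem exists_mulVec_eq_of_notMem {F ι : Type*} [Field F] [Fintype ι] [DecidableEq ι]
    {U : Submodule F (ι → F)} {w : ι → F} (hw : w ∉ U) (v : ι → F) :
    ∃ M : Matrix ι ι F, M *ᵥ w = v ∧ ∀ u ∈ U, M *ᵥ u = 0 := by
  obtain ⟨φ, hφ, hU⟩ := Submodule.exists_le_ker_of_notMem hw
  refine ⟨LinearMap.toMatrix' (φ.smulRight ((φ w)⁻¹ • v)), ?_, fun u hu ↦ ?_⟩
  · simp [LinearMap.toMatrix'_mulVec, smul_smul, hφ]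
  · have : φ u = 0 := hU hu
    simp [LinearMap.toMatrix'_mulVec, this]

/-- The ring of matrices stabilizing a subspace. -/
def matrixStabilizer {F ι : Type*} [Field F] [Fintype ι] (U : Submodule F (ι → F)) :
    NonUnitalSubring (Matrix ι ι F) where
  carrier := {M | ∀ v ∈ U, M.mulVec v ∈ U}
  mul_mem' hM hN v hv := by
    rw [← mulVec_mulVec]
    exact hM _ (hN v hv)
  add_mem' hM hN v hv := by
    rw [add_mulVec]
    exact U.add_mem (hM v hv) (hN v hv)
  zero_mem' v _ := by simp
  neg_mem' hM v hv := by
    rw [neg_mulVec]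
    exact U.neg_mem (hM v hv)

theorem mem_matrixStabilizer {F ι : Type*} [Field F] [Fintype ι] {U : Submodule F (ι → F)}
    {M : Matrix ι ι F} : M ∈ matrixStabilizer U ↔ ∀ v ∈ U, M *ᵥ v ∈ U := Iff.rfl

theorem le_of_matrixStabilizer_le {F ι : Type*} [Field F] [Fintype ι] [DecidableEq ι]
    {U W : Submodule F (ι → F)} (hW : W ≠ ⊤) (h : matrixStabilizer U ≤ matrixStabilizer W) :
    W ≤ U := by
  intro w hw
  by_contra hwU
  refine hW (eq_top_iff.2 fun v _ ↦ ?_)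
  obtain ⟨M, rfl, hM⟩ := exists_mulVec_eq_of_notMem hwU v
  exact h (mem_matrixStabilizer.2 fun u hu ↦ hM u hu ▸ U.zero_mem) w hw

theorem matrixStabilizer_ne_top {F ι : Type*} [Field F] [Fintype ι] [DecidableEq ι]
    {U : Submodule F (ι → F)} (h₀ : U ≠ ⊥) (h₁ : U ≠ ⊤) : matrixStabilizer U ≠ ⊤ := by
  intro h
  have hle : matrixStabilizer (⊥ : Submodule F (ι → F)) ≤ matrixStabilizer U := h ▸ le_top
  exact h₀ (eq_bot_iff.2 (le_of_matrixStabilizer_le h₁ hle))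

theorem finrank_dvd_finrank_of_range_subset_stabilizer {F K : Type*} [Field F] [Field K]
    [Algebra F K] [FiniteDimensional F K] {n : ℕ} (φ : K →ₐ[F] Matrix (Fin n) (Fin n) F)
    {U : Submodule F (Fin n → F)} (hU : Set.range φ ⊆ matrixStabilizer U) :
    finrank F K ∣ finrank F U := by
  let ψ : K →ₐ[F] End F (Fin n → F) :=
    (Matrix.toLinAlgEquiv' (R := F) (n := Fin n)).toAlgHom.comp φ
  let : Module K (Fin n → F) := Module.compHom _ ψ.toRingHom
  have hsmul (c : K) (v : Fin n → F) : c • v = φ c *ᵥ v := rfl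
  have : IsScalarTower F K (Fin n → F) := ⟨fun a c v ↦ by
    rw [hsmul, hsmul, map_smul, smul_mulVec]⟩
  let W : Submodule K (Fin n → F) :=
    { U with smul_mem' := fun c u hu ↦ hU (Set.mem_range_self c) u hu }
  exact ⟨finrank K W, (Module.finrank_mul_finrank F K W).symm⟩

end Stabilizer

section Covering

variable {F : Type} [Field F] [Fintype F] {n : ℕ}

theorem isExtConjugate_iff {K : Type} [Field K] [Algebra F K] [FiniteDimensional F K] {m : ℕ}
    (hm : m ≠ 0) (hn : n = finrank F K * m) (S : NonUnitalSubring (Matrix (Fin n) (Fin n) F)) :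
    IsExtConjugate F n (finrank F K) S ↔ ∃ φ : K →ₐ[F] Matrix (Fin n) (Fin n) F,
      S = NonUnitalSubring.centralizer (Set.range φ) := by
  have : Finite K := Module.finite_of_finite F
  have := Fintype.ofFinite K
  have hdiv : n / finrank F K = m := by rw [hn, Nat.mul_div_cancel_left _ finrank_pos]
  unfold IsExtConjugate
  rw [hdiv]
  simp only [← SetLike.coe_set_eq, NonUnitalSubring.coe_centralizer]
  constructor
  · rintro ⟨L, _, _, hL, f, hf, hS⟩
    obtain ⟨_, φ, hφ⟩ := exists_algebra_range_eq_centralizer hm (by rw [hL, hn, pow_mul]) f hf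
    have hLF : finrank F L = finrank F K := by
      refine Nat.pow_right_injective (Fintype.one_lt_card : 2 ≤ Fintype.card F) ?_
      simp only [← hL, ← Module.card_eq_pow_finrank]
    obtain ⟨ι⟩ := FiniteField.nonempty_algHom_of_finrank_dvd (F := F) (K := K) (L := L)
      hLF.symm.dvd
    have hι : Function.Surjective ι :=
      (LinearMap.injective_iff_surjective_of_finrank_eq_finrank (f := ι.toLinearMap) hLF.symm).1
        ι.toRingHom.injective
    exact ⟨φ.comp ι, by rw [hS, hφ, AlgHom.coe_comp, hι.range_comp]⟩
  · rintro ⟨φ, hS⟩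
    obtain ⟨e, rfl⟩ := exists_scalarConjHom_eq hn φ
    exact ⟨K, inferInstance, inferInstance, Module.card_eq_pow_finrank, matrixConjHom e,
      matrixConjHom_injective e, by rw [hS, range_matrixConjHom]⟩

theorem isSmallStabilizer_iff (S : NonUnitalSubring (Matrix (Fin n) (Fin n) F)) :
    IsSmallStabilizer F n S ↔ ∃ U : Submodule F (Fin n → F),
      (¬ n.minFac ∣ finrank F U ∧ 2 * finrank F U ≤ n) ∧ matrixStabilizer U = S := by
  simp only [IsSmallStabilizer, ← SetLike.coe_set_eq, and_assoc]
  exact exists_congr fun U ↦ and_congr_right' (and_congr_right' eq_comm)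

theorem ne_bot_and_ne_top_of_not_dvd_finrank {F : Type*} [Field F] {n b : ℕ} (hn : n ≠ 0)
    {U : Submodule F (Fin n → F)} (hU : ¬ b ∣ finrank F U ∧ 2 * finrank F U ≤ n) :
    U ≠ ⊥ ∧ U ≠ ⊤ := by
  constructor
  · rintro rfl
    exact hU.1 (by simp)
  · rintro rfl
    have := hU.2
    rw [finrank_top, finrank_fin_fun] at this
    omega

theorem not_isExtConjugate_matrixStabilizer {K : Type} [Field K] [Algebra F K]
    [FiniteDimensional F K] {m : ℕ} (hm : m ≠ 0) (hn : n = finrank F K * m)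
    {U : Submodule F (Fin n → F)} (hU : ¬ finrank F K ∣ finrank F U)
    {S : NonUnitalSubring (Matrix (Fin n) (Fin n) F)} (hS : S ≤ matrixStabilizer U) :
    ¬ IsExtConjugate F n (finrank F K) S := by
  rw [isExtConjugate_iff hm hn]
  rintro ⟨φ, rfl⟩
  refine hU (finrank_dvd_finrank_of_range_subset_stabilizer φ fun y hy ↦ hS ?_)
  obtain ⟨c, rfl⟩ := hy
  rw [NonUnitalSubring.mem_centralizer_iff]
  rintro _ ⟨d, rfl⟩
  rw [← map_mul, ← map_mul, mul_comm]

theorem isExtConjugate_ne_top {K : Type} [Field K] [Algebra F K] [FiniteDimensional F K] {m : ℕ}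
    (hm : m ≠ 0) (hn : n = finrank F K * m) (hK : finrank F K ≠ 1)
    {S : NonUnitalSubring (Matrix (Fin n) (Fin n) F)}
    (hS : IsExtConjugate F n (finrank F K) S) : S ≠ ⊤ := by
  rintro rfl
  have hn0 : n ≠ 0 := hn ▸ mul_ne_zero finrank_pos.ne' hm
  let i : Fin n := ⟨0, Nat.pos_of_ne_zero hn0⟩
  let U : Submodule F (Fin n → F) := Submodule.span F {Pi.single i 1}
  have hU : finrank F U = 1 := finrank_span_singleton (by simp)
  rw [isExtConjugate_iff hm hn] at hS
  obtain ⟨φ, hφ⟩ := hS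
  have hcomm (c : K) (M : Matrix (Fin n) (Fin n) F) : φ c * M = M * φ c := by
    have hM : M ∈ NonUnitalSubring.centralizer (Set.range φ) := hφ ▸ NonUnitalSubring.mem_top M
    exact NonUnitalSubring.mem_centralizer_iff.1 hM _ ⟨c, rfl⟩
  have hdvd : finrank F K ∣ finrank F U := by
    refine finrank_dvd_finrank_of_range_subset_stabilizer φ ?_
    rintro _ ⟨c, rfl⟩ u hu
    obtain ⟨a, rfl⟩ := Submodule.mem_span_singleton.1 hu
    rw [mulVec_smul]
    refine U.smul_mem a (Submodule.mem_span_singleton.2 ⟨φ c i i, ?_⟩)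
    have := congrArg (· *ᵥ Pi.single i 1)
      (hcomm c (vecMulVec (Pi.single i 1) (Pi.single i 1)))
    simp only [← mulVec_mulVec, vecMulVec_mulVec] at this
    simpa using this.symm
  exact hK (Nat.dvd_one.1 (hU ▸ hdvd))

theorem card_isExtConjugate {K : Type} [Field K] [Algebra F K] [FiniteDimensional F K] {m : ℕ}
    (hm : m ≠ 0) (hn : n = finrank F K * m) :
    Nat.card {S : NonUnitalSubring (Matrix (Fin n) (Fin n) F) //
        IsExtConjugate F n (finrank F K) S} =
      (∏ i ∈ (Finset.range n).filter (fun i => ¬ finrank F K ∣ i),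
        (Fintype.card F ^ n - Fintype.card F ^ i)) / finrank F K := by
  have : Finite K := Module.finite_of_finite F
  have hn0 : n ≠ 0 := hn ▸ mul_ne_zero finrank_pos.ne' hm
  have : Finite (K →ₐ[F] Matrix (Fin n) (Fin n) F) :=
    Finite.of_injective (fun φ ↦ (φ : K → Matrix (Fin n) (Fin n) F)) DFunLike.coe_injective
  have : Finite (NonUnitalSubring (Matrix (Fin n) (Fin n) F)) :=
    Finite.of_injective _ SetLike.coe_injective
  rw [← card_algHom_matrix hn]
  refine (Nat.div_eq_of_eq_mul_left finrank_pos ?_).symm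
  refine Nat.card_eq_card_mul_of_forall_card_fiber (fun φ ↦
    ⟨NonUnitalSubring.centralizer (Set.range φ), (isExtConjugate_iff hm hn _).2 ⟨φ, rfl⟩⟩) ?_
  rintro ⟨S, hS⟩
  obtain ⟨φ₀, rfl⟩ := (isExtConjugate_iff hm hn _).1 hS
  refine Eq.trans ?_ (card_algHom_fiber_range φ₀ hn0)
  refine Nat.card_congr (Equiv.subtypeEquivRight fun φ ↦ ?_)
  rw [Subtype.mk.injEq, ← SetLike.coe_set_eq, NonUnitalSubring.coe_centralizer,
    NonUnitalSubring.coe_centralizer]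
  refine ⟨fun h ↦ ?_, fun h ↦ by rw [h]⟩
  rw [← centralizer_centralizer_range hm hn φ, h, centralizer_centralizer_range hm hn]

theorem card_isSmallStabilizer (hn : n ≠ 0) :
    Nat.card {S : NonUnitalSubring (Matrix (Fin n) (Fin n) F) // IsSmallStabilizer F n S} =
      Nat.card {U : Submodule F (Fin n → F) //
        ¬ n.minFac ∣ finrank F U ∧ 2 * finrank F U ≤ n} := by
  symm
  refine Nat.card_eq_of_bijective (fun U ↦ ⟨matrixStabilizer U.1,
    (isSmallStabilizer_iff _).2 ⟨U.1, U.2, rfl⟩⟩) ⟨fun U W h ↦ ?_, fun ⟨S, hS⟩ ↦ ?_⟩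
  · have h' : matrixStabilizer U.1 = matrixStabilizer W.1 := congrArg Subtype.val h
    exact Subtype.ext (le_antisymm
      (le_of_matrixStabilizer_le (ne_bot_and_ne_top_of_not_dvd_finrank hn U.2).2 h'.ge)
      (le_of_matrixStabilizer_le (ne_bot_and_ne_top_of_not_dvd_finrank hn W.2).2 h'.le))
  · obtain ⟨U, hU, rfl⟩ := (isSmallStabilizer_iff S).1 hS
    exact ⟨⟨U, hU⟩, rfl⟩

end Covering

end

/-- Let `n ≥ 2`, `F` a finite field of order `q`, and `b` the smallest prime
divisor of `n`.  Let `N(b)` be the number of subspaces of `F^n` of dimension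
`k` with `b ∤ k` and `k ≤ n/2`.  The family `𝓗` consisting of all
`GL(n,q)`-conjugates of `M_{n/b}(q^b)` together with all stabilizers `M(U)`
with `b ∤ dim U` and `dim U ≤ n/2` is a family of proper subrings covering
`Mₙ(q)`, of cardinality `(1/b)·∏_{1 ≤ i ≤ n-1, b ∤ i}(qⁿ − qⁱ) + N(b)`; hence
`σ(Mₙ(q))`, the least number of proper subrings of `Mₙ(q)` whose union is
`Mₙ(q)`, is at most this number. -/
theorem sigma_matrix_ring_upper_bound
    (F : Type) [Field F] [Fintype F] (n : ℕ) (hn : 2 ≤ n) :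
    (∀ S : NonUnitalSubring (Matrix (Fin n) (Fin n) F),
      (IsExtConjugate F n n.minFac S ∨ IsSmallStabilizer F n S) → S ≠ ⊤) ∧
    (∀ x : Matrix (Fin n) (Fin n) F, ∃ S : NonUnitalSubring (Matrix (Fin n) (Fin n) F),
      (IsExtConjugate F n n.minFac S ∨ IsSmallStabilizer F n S) ∧ x ∈ S) ∧
    Nat.card {S : NonUnitalSubring (Matrix (Fin n) (Fin n) F) //
        IsExtConjugate F n n.minFac S ∨ IsSmallStabilizer F n S} =
      (∏ i ∈ (Finset.range n).filter (fun i => ¬ n.minFac ∣ i),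
          (Fintype.card F ^ n - Fintype.card F ^ i)) / n.minFac +
        Nat.card {U : Submodule F (Fin n → F) //
          ¬ n.minFac ∣ Module.finrank F U ∧ 2 * Module.finrank F U ≤ n} ∧
    sInf {k : ℕ | ∃ 𝒞 : Finset (NonUnitalSubring (Matrix (Fin n) (Fin n) F)),
        𝒞.card = k ∧ (∀ S ∈ 𝒞, S ≠ ⊤) ∧
        ∀ x : Matrix (Fin n) (Fin n) F, ∃ S ∈ 𝒞, x ∈ S} ≤
      (∏ i ∈ (Finset.range n).filter (fun i => ¬ n.minFac ∣ i),
          (Fintype.card F ^ n - Fintype.card F ^ i)) / n.minFac +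
        Nat.card {U : Submodule F (Fin n → F) //
          ¬ n.minFac ∣ Module.finrank F U ∧ 2 * Module.finrank F U ≤ n} := by
  obtain ⟨p, hp⟩ := CharP.exists F
  have : Fact p.Prime := ⟨CharP.char_is_prime F p⟩
  have hb : n.minFac.Prime := Nat.minFac_prime (by omega)
  have : NeZero n.minFac := ⟨hb.ne_zero⟩
  obtain ⟨K, _, _, _, hK⟩ : ∃ (K : Type) (_ : Field K) (_ : Algebra F K)
      (_ : FiniteDimensional F K), Module.finrank F K = n.minFac :=
    ⟨FiniteField.Extension F p n.minFac, inferInstance, inferInstance, inferInstance,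
      FiniteField.finrank_extension F p n.minFac⟩
  obtain ⟨m, hm⟩ := n.minFac_dvd
  have hm0 : m ≠ 0 := by
    rintro rfl
    omega
  have hnm : n = Module.finrank F K * m := by rwa [hK]
  have hproper : ∀ S : NonUnitalSubring (Matrix (Fin n) (Fin n) F),
      (IsExtConjugate F n n.minFac S ∨ IsSmallStabilizer F n S) → S ≠ ⊤ := by
    rintro S (hS | hS)
    · rw [← hK] at hS
      exact isExtConjugate_ne_top hm0 hnm (by rw [hK]; exact hb.ne_one) hS
    · obtain ⟨U, hU, rfl⟩ := (isSmallStabilizer_iff S).1 hS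
      have := ne_bot_and_ne_top_of_not_dvd_finrank (by omega) hU
      exact matrixStabilizer_ne_top this.1 this.2
  have hcover : ∀ x : Matrix (Fin n) (Fin n) F,
      ∃ S : NonUnitalSubring (Matrix (Fin n) (Fin n) F),
        (IsExtConjugate F n n.minFac S ∨ IsSmallStabilizer F n S) ∧ x ∈ S := by
    intro x
    rcases exists_invariant_submodule_or_algHom_commute (K := K)
      (by rw [Module.finrank_fin_fun, hK]; exact n.minFac_dvd) (Matrix.toLinAlgEquiv' x) with
      ⟨U, hdvd, hle, hxU⟩ | ⟨φ, hφ⟩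
    · rw [hK] at hdvd
      rw [Module.finrank_fin_fun] at hle
      exact ⟨matrixStabilizer U, Or.inr ((isSmallStabilizer_iff _).2 ⟨U, ⟨hdvd, hle⟩, rfl⟩), hxU⟩
    · let e := Matrix.toLinAlgEquiv' (R := F) (n := Fin n)
      refine ⟨NonUnitalSubring.centralizer (Set.range (e.symm.toAlgHom.comp φ)), Or.inl ?_, ?_⟩
      · rw [← hK, isExtConjugate_iff hm0 hnm]
        exact ⟨_, rfl⟩
      · rw [NonUnitalSubring.mem_centralizer_iff]
        rintro _ ⟨c, rfl⟩
        apply e.injective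
        simpa using (hφ c).eq
  have hdisj : Disjoint (IsExtConjugate F n n.minFac) (IsSmallStabilizer F n) := by
    rw [Pi.disjoint_iff]
    intro S
    rw [disjoint_iff_inf_le]
    rintro ⟨hS, hS'⟩
    obtain ⟨U, hU, rfl⟩ := (isSmallStabilizer_iff S).1 hS'
    rw [← hK] at hS hU
    exact not_isExtConjugate_matrixStabilizer hm0 hnm hU.1 le_rfl hS
  have : Finite (NonUnitalSubring (Matrix (Fin n) (Fin n) F)) :=
    Finite.of_injective _ SetLike.coe_injective
  have hcard : Nat.card {S : NonUnitalSubring (Matrix (Fin n) (Fin n) F) //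
        IsExtConjugate F n n.minFac S ∨ IsSmallStabilizer F n S} =
      (∏ i ∈ (Finset.range n).filter (fun i => ¬ n.minFac ∣ i),
          (Fintype.card F ^ n - Fintype.card F ^ i)) / n.minFac +
        Nat.card {U : Submodule F (Fin n → F) //
          ¬ n.minFac ∣ Module.finrank F U ∧ 2 * Module.finrank F U ≤ n} := by
    classical
    rw [Nat.card_congr (subtypeOrEquiv _ _ hdisj), Nat.card_sum,
      card_isSmallStabilizer (by omega)]
    congr 1
    simpa only [hK] using card_isExtConjugate (F := F) (K := K) hm0 hnm
  refine ⟨hproper, hcover, hcard, ?_⟩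
  rw [← hcard]
  refine Nat.sInf_le ⟨(Set.toFinite {S : NonUnitalSubring (Matrix (Fin n) (Fin n) F) |
    IsExtConjugate F n n.minFac S ∨ IsSmallStabilizer F n S}).toFinset, ?_, ?_, ?_⟩
  · rw [← Set.ncard_eq_toFinset_card]
    rfl
  · intro S hS
    exact hproper S ((Set.Finite.mem_toFinset _).1 hS :)
  · intro x
    obtain ⟨S, hS, hxS⟩ := hcover x
    exact ⟨S, (Set.Finite.mem_toFinset _).2 hS, hxS⟩
end
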